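/- Let D_0 be the set of linear endomorphisms A of the 24-dimensional 2-step nilpotent Lie algebra n_{E_III} = n_{−2} ⊕ n_{−1} satisfying A(n_{−1}) ⊆ n_{−1}, A(n_{−2}) ⊆ n_{−2}, and A[v,w] = [Av,w] + [v,Aw] for all v,w ∈ n_{E_III} (strata-preserving derivations). Then D_0 is a Lie subalgebra of gl(n_{E_III}) (under the commutator bracket) of real dimension 30. -/

import Mathlib

noncomputable section
open ComplexConjugate

/-- Points of `ℝ²⁴`, with coordinates `u^i = p (i-1)`, `x^i = p (7+i)`, `y^i = p (15+i)`
for `i = 1, …, 8`. -/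
abbrev Pt : Type := Fin 24 → ℝ
/-- The bracket of the 24-dimensional 2-step nilpotent Lie algebra `n_{E_III}`, in the
basis `X_1, …, X_24` (indexed here by `0, …, 23`): for each term `ε·λ^B∧λ^D` in the E_III
structure equations one has `[X_B, X_D] = -ε·X_A`, and `X_1, …, X_8` are central. -/
def br (v w : Pt) : Pt := fun k =>
  if h : (k : ℕ) < 8 then
    (![-((v 8 * w 23 - v 23 * w 8) + (v 9 * w 19 - v 19 * w 9)
        + (v 10 * w 22 - v 22 * w 10) + (v 11 * w 17 - v 17 * w 11)
        + (v 12 * w 21 - v 21 * w 12) + (v 13 * w 20 - v 20 * w 13)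
        + (v 14 * w 18 - v 18 * w 14) + (v 15 * w 16 - v 16 * w 15)),
       -((v 8 * w 19 - v 19 * w 8) + (v 23 * w 9 - v 9 * w 23)
        + (v 21 * w 10 - v 10 * w 21) + (v 11 * w 16 - v 16 * w 11)
        + (v 12 * w 22 - v 22 * w 12) + (v 18 * w 13 - v 13 * w 18)
        + (v 14 * w 20 - v 20 * w 14) + (v 17 * w 15 - v 15 * w 17)),
       -((v 8 * w 22 - v 22 * w 8) + (v 9 * w 21 - v 21 * w 9)
        + (v 23 * w 10 - v 10 * w 23) + (v 20 * w 11 - v 11 * w 20)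
        + (v 19 * w 12 - v 12 * w 19) + (v 13 * w 17 - v 17 * w 13)
        + (v 14 * w 16 - v 16 * w 14) + (v 18 * w 15 - v 15 * w 18)),
       -((v 9 * w 8 - v 8 * w 9) + (v 12 * w 10 - v 10 * w 12)
        + (v 15 * w 11 - v 11 * w 15) + (v 14 * w 13 - v 13 * w 14)
        + (v 17 * w 16 - v 16 * w 17) + (v 20 * w 18 - v 18 * w 20)
        + (v 23 * w 19 - v 19 * w 23) + (v 22 * w 21 - v 21 * w 22)),
       -((v 8 * w 21 - v 21 * w 8) + (v 22 * w 9 - v 9 * w 22)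
        + (v 10 * w 19 - v 19 * w 10) + (v 11 * w 18 - v 18 * w 11)
        + (v 23 * w 12 - v 12 * w 23) + (v 13 * w 16 - v 16 * w 13)
        + (v 17 * w 14 - v 14 * w 17) + (v 20 * w 15 - v 15 * w 20)),
       -((v 12 * w 8 - v 8 * w 12) + (v 10 * w 9 - v 9 * w 10)
        + (v 11 * w 14 - v 14 * w 11) + (v 15 * w 13 - v 13 * w 15)
        + (v 20 * w 16 - v 16 * w 20) + (v 18 * w 17 - v 17 * w 18)
        + (v 19 * w 22 - v 22 * w 19) + (v 23 * w 21 - v 21 * w 23)),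
       -((v 10 * w 8 - v 8 * w 10) + (v 9 * w 12 - v 12 * w 9)
        + (v 13 * w 11 - v 11 * w 13) + (v 15 * w 14 - v 14 * w 15)
        + (v 18 * w 16 - v 16 * w 18) + (v 17 * w 20 - v 20 * w 17)
        + (v 21 * w 19 - v 19 * w 21) + (v 23 * w 22 - v 22 * w 23)),
       -((v 8 * w 16 - v 16 * w 8) + (v 9 * w 17 - v 17 * w 9)
        + (v 10 * w 18 - v 18 * w 10) + (v 11 * w 19 - v 19 * w 11)
        + (v 12 * w 20 - v 20 * w 12) + (v 13 * w 21 - v 21 * w 13)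
        + (v 14 * w 22 - v 22 * w 14) + (v 15 * w 23 - v 23 * w 15))] : Fin 8 → ℝ) ⟨k, h⟩
  else 0
/-- The stratum `n_{-2} = span (X_1, …, X_8)`. -/
def Nm2 : Submodule ℝ Pt where
  carrier := {v | ∀ k : Fin 24, 8 ≤ (k : ℕ) → v k = 0}
  add_mem' := by
    intro a b ha hb
    simp only [Set.mem_setOf_eq] at ha hb ⊢
    intro k hk
    simp [Pi.add_apply, ha k hk, hb k hk]
  zero_mem' := by intro k _; rfl
  smul_mem' := by
    intro c v hv
    simp only [Set.mem_setOf_eq] at hv ⊢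
    intro k hk
    simp [Pi.smul_apply, hv k hk]

/-- The stratum `n_{-1} = span (X_9, …, X_24)`. -/
def Nm1 : Submodule ℝ Pt where
  carrier := {v | ∀ k : Fin 24, (k : ℕ) < 8 → v k = 0}
  add_mem' := by
    intro a b ha hb
    simp only [Set.mem_setOf_eq] at ha hb ⊢
    intro k hk
    simp [Pi.add_apply, ha k hk, hb k hk]
  zero_mem' := by intro k _; rfl
  smul_mem' := by
    intro c v hv
    simp only [Set.mem_setOf_eq] at hv ⊢
    intro k hk
    simp [Pi.smul_apply, hv k hk]
/-- A strata-preserving derivation: a linear endomorphism `A` with `A (n_{-1}) ⊆ n_{-1}`,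
`A (n_{-2}) ⊆ n_{-2}`, and `A [v, w] = [A v, w] + [v, A w]`. -/
def IsSPDer (A : Module.End ℝ Pt) : Prop :=
  (∀ v ∈ Nm1, A v ∈ Nm1) ∧ (∀ v ∈ Nm2, A v ∈ Nm2) ∧
    ∀ v w : Pt, A (br v w) = br (A v) w + br v (A w)

open Matrix

/-- The underlying permutation of the `k`-th structure matrix: `X_{8+i}` and `X_{8+σ k i}` are
the only basis vectors of `n_{-1}` whose bracket is a multiple of `X_k`. -/
def partner : Fin 8 → Fin 16 → Fin 16 :=
  ![![15, 11, 14, 9, 13, 12, 10, 8, 7, 3, 6, 1, 5, 4, 2, 0],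
    ![11, 15, 13, 8, 14, 10, 12, 9, 3, 7, 5, 0, 6, 2, 4, 1],
    ![14, 13, 15, 12, 11, 9, 8, 10, 6, 5, 7, 4, 3, 1, 0, 2],
    ![1, 0, 4, 7, 2, 6, 5, 3, 9, 8, 12, 15, 10, 14, 13, 11],
    ![13, 14, 11, 10, 15, 8, 9, 12, 5, 6, 3, 2, 7, 0, 1, 4],
    ![4, 2, 1, 6, 0, 7, 3, 5, 12, 10, 9, 14, 8, 15, 11, 13],
    ![2, 4, 0, 5, 1, 3, 7, 6, 10, 12, 8, 13, 9, 11, 15, 14],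
    ![8, 9, 10, 11, 12, 13, 14, 15, 0, 1, 2, 3, 4, 5, 6, 7]]

/-- The sign of the bracket of `X_{8+i}` with its `k`-th partner. -/
def partnerSign : Fin 8 → Fin 16 → ℤ :=
  ![![-1, -1, -1, -1, -1, -1, -1, -1, 1, 1, 1, 1, 1, 1, 1, 1],
    ![-1, 1, 1, -1, -1, 1, -1, 1, 1, -1, -1, 1, 1, -1, 1, -1],
    ![-1, -1, 1, 1, 1, -1, -1, 1, 1, 1, -1, -1, -1, 1, 1, -1],
    ![1, -1, 1, 1, -1, 1, -1, -1, 1, -1, 1, 1, -1, 1, -1, -1],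
    ![-1, 1, -1, -1, 1, -1, 1, 1, 1, -1, 1, 1, -1, 1, -1, -1],
    ![1, 1, -1, -1, -1, 1, 1, -1, 1, 1, -1, -1, -1, 1, 1, -1],
    ![1, -1, -1, 1, 1, -1, 1, -1, 1, -1, -1, 1, 1, -1, 1, -1],
    ![-1, -1, -1, -1, -1, -1, -1, -1, 1, 1, 1, 1, 1, 1, 1, 1]]

/-- The commutation sign of the structure matrices: the first seven anticommute pairwise, and
the last one is central. -/
def commSign (k l : Fin 8) : ℤ := if k = l ∨ k = 7 ∨ l = 7 then 1 else -1

lemma partner_partner (k : Fin 8) (i : Fin 16) : partner k (partner k i) = i := by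
  revert k i; decide +kernel

lemma partnerSign_partner (k : Fin 8) (i : Fin 16) :
    partnerSign k (partner k i) = -partnerSign k i := by
  revert k i; decide +kernel

lemma partnerSign_mul_self (k : Fin 8) (i : Fin 16) : partnerSign k i * partnerSign k i = 1 := by
  revert k i; decide +kernel

lemma partner_comm (k l : Fin 8) (i : Fin 16) :
    partner l (partner k i) = partner k (partner l i) := by
  revert k l i; decide +kernel

lemma partnerSign_comm (k l : Fin 8) (i : Fin 16) :
    partnerSign k i * partnerSign l (partner k i) =
      commSign k l * (partnerSign l i * partnerSign k (partner l i)) := by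
  revert k l i; decide +kernel

lemma partner_partner_ne (k l : Fin 8) (h : k ≠ l) (i : Fin 16) :
    partner l (partner k i) ≠ i := by
  revert k l i; decide +kernel

/-- The matrix of the `k`-th component of the bracket `n_{-1} × n_{-1} → n_{-2}`. -/
def structMat (k : Fin 8) : Matrix (Fin 16) (Fin 16) ℝ :=
  fun i j => if j = partner k i then (partnerSign k i : ℝ) else 0

lemma structMat_mul_apply (k : Fin 8) (X : Matrix (Fin 16) (Fin 16) ℝ) (i j : Fin 16) :
    (structMat k * X) i j = partnerSign k i * X (partner k i) j := by
  simp [Matrix.mul_apply, structMat]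

lemma structMat_transpose (k : Fin 8) : (structMat k)ᵀ = -structMat k := by
  ext i j
  simp only [Matrix.transpose_apply, Matrix.neg_apply, structMat]
  by_cases h : i = partner k j
  · subst h
    simp [partner_partner, partnerSign_partner]
  · have h' : j ≠ partner k i := fun e => h (by rw [e, partner_partner])
    simp [h, h']

lemma mul_structMat_apply (k : Fin 8) (X : Matrix (Fin 16) (Fin 16) ℝ) (i j : Fin 16) :
    (X * structMat k) i j = -(partnerSign k j * X i (partner k j)) := by
  have h := structMat_mul_apply k Xᵀ j i
  rw [Matrix.transpose_apply] at h
  rw [← h, ← Matrix.transpose_apply (_ * _), Matrix.transpose_mul, structMat_transpose]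
  simp

lemma structMat_mul_self (k : Fin 8) : structMat k * structMat k = -1 := by
  ext i j
  have h : (partnerSign k i * partnerSign k i : ℝ) = 1 := mod_cast partnerSign_mul_self k i
  rw [structMat_mul_apply, structMat, partner_partner, partnerSign_partner, Matrix.neg_apply,
    Matrix.one_apply]
  by_cases e : i = j
  · simp [e ▸ h, e]
  · simp [e, Ne.symm e]

lemma structMat_mul_comm (k l : Fin 8) :
    structMat k * structMat l = (commSign k l : ℝ) • (structMat l * structMat k) := by
  ext i j
  have h : (partnerSign k i * partnerSign l (partner k i) : ℝ) =
      commSign k l * (partnerSign l i * partnerSign k (partner l i)) :=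
    mod_cast partnerSign_comm k l i
  simp only [structMat_mul_apply, Matrix.smul_apply, structMat, smul_eq_mul, partner_comm k l i]
  split_ifs
  · exact h
  · simp

lemma trace_structMat_mul (k l : Fin 8) :
    (structMat k * structMat l).trace = if k = l then -16 else 0 := by
  split_ifs with h
  · subst h
    simp [structMat_mul_self]
  · refine Finset.sum_eq_zero fun i _ => ?_
    simp [structMat_mul_apply, structMat, (partner_partner_ne k l h i).symm]

lemma br_castAdd (v w : Pt) (k : Fin 8) :
    br v w (Fin.castAdd 16 k) =
      (fun a => v (Fin.natAdd 8 a)) ⬝ᵥ structMat k *ᵥ fun a => w (Fin.natAdd 8 a) := by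
  have h : (fun a => v (Fin.natAdd 8 a)) ⬝ᵥ (structMat k *ᵥ fun a => w (Fin.natAdd 8 a)) =
      ∑ a, v (Fin.natAdd 8 a) * (partnerSign k a * w (Fin.natAdd 8 (partner k a))) := by
    simp [dotProduct, Matrix.mulVec, structMat]
  rw [h]
  simp only [Fin.sum_univ_succ, Fin.sum_univ_zero]
  fin_cases k <;> simp [br, partner, partnerSign] <;> ring

lemma br_natAdd (v w : Pt) (a : Fin 16) : br v w (Fin.natAdd 8 a) = 0 := by
  simp [br]

/-- Pairs of matrices on `n_{-1}` and `n_{-2}` satisfying the Leibniz rule for the bracket. -/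
def derPairs : Submodule ℝ (Matrix (Fin 16) (Fin 16) ℝ × Matrix (Fin 8) (Fin 8) ℝ) where
  carrier := {P | ∀ k, P.1ᵀ * structMat k + structMat k * P.1 = ∑ l, P.2 k l • structMat l}
  add_mem' {P Q} hP hQ k := by
    simp only [Prod.fst_add, Prod.snd_add, Matrix.transpose_add, Matrix.add_apply, add_mul,
      mul_add, add_smul, Finset.sum_add_distrib, ← hP k, ← hQ k]
    abel
  zero_mem' k := by simp
  smul_mem' c P hP k := by
    simp [← smul_add, hP k, Finset.smul_sum, mul_smul]

/-- The block-diagonal endomorphism of `n_{E_III}` with the given blocks. -/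
def blockEnd :
    Matrix (Fin 16) (Fin 16) ℝ × Matrix (Fin 8) (Fin 8) ℝ →ₗ[ℝ] Module.End ℝ Pt where
  toFun P :=
    { toFun v := Fin.append (P.2 *ᵥ fun k => v (Fin.castAdd 16 k))
        (P.1 *ᵥ fun a => v (Fin.natAdd 8 a))
      map_add' v w := by
        ext i
        refine Fin.addCases (m := 8) (n := 16) (fun k => ?_) (fun a => ?_) i
        · simp only [Pi.add_apply, Fin.append_left]
          exact congrFun (Matrix.mulVec_add _ _ _) k
        · simp only [Pi.add_apply, Fin.append_right]
          exact congrFun (Matrix.mulVec_add _ _ _) a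
      map_smul' c v := by
        ext i
        refine Fin.addCases (m := 8) (n := 16) (fun k => ?_) (fun a => ?_) i
        · simp only [Pi.smul_apply, Fin.append_left, RingHom.id_apply]
          exact congrFun (Matrix.mulVec_smul P.2 c fun k => v (Fin.castAdd 16 k)) k
        · simp only [Pi.smul_apply, Fin.append_right, RingHom.id_apply]
          exact congrFun (Matrix.mulVec_smul P.1 c fun a => v (Fin.natAdd 8 a)) a }
  map_add' P Q := by
    ext v i
    refine Fin.addCases (m := 8) (n := 16) (fun k => ?_) (fun a => ?_) i <;>
      simp [Matrix.add_mulVec]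
  map_smul' c P := by
    ext v i
    refine Fin.addCases (m := 8) (n := 16) (fun k => ?_) (fun a => ?_) i <;>
      simp [Matrix.smul_mulVec]

lemma single_natAdd_natAdd (b : Fin 16) :
    (fun a : Fin 16 => (Pi.single (Fin.natAdd 8 b) 1 : Pt) (Fin.natAdd 8 a)) = Pi.single b 1 := by
  ext a
  simp [Pi.single_apply, Fin.ext_iff]

lemma single_natAdd_castAdd (b : Fin 16) :
    (fun k : Fin 8 => (Pi.single (Fin.natAdd 8 b) 1 : Pt) (Fin.castAdd 16 k)) = 0 := by
  ext k
  simp only [Pi.single_apply, Fin.ext_iff, Fin.val_castAdd, Fin.val_natAdd, Pi.zero_apply]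
  exact if_neg (by omega)

lemma single_castAdd_castAdd (l : Fin 8) :
    (fun k : Fin 8 => (Pi.single (Fin.castAdd 16 l) 1 : Pt) (Fin.castAdd 16 k)) =
      Pi.single l 1 := by
  ext k
  simp [Pi.single_apply, Fin.ext_iff]

lemma single_castAdd_natAdd (l : Fin 8) :
    (fun a : Fin 16 => (Pi.single (Fin.castAdd 16 l) 1 : Pt) (Fin.natAdd 8 a)) = 0 := by
  ext a
  simp only [Pi.single_apply, Fin.ext_iff, Fin.val_castAdd, Fin.val_natAdd, Pi.zero_apply]
  exact if_neg (by omega)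

section BlockEnd

variable (P : Matrix (Fin 16) (Fin 16) ℝ × Matrix (Fin 8) (Fin 8) ℝ)

lemma blockEnd_castAdd (v : Pt) (k : Fin 8) :
    blockEnd P v (Fin.castAdd 16 k) = (P.2 *ᵥ fun l => v (Fin.castAdd 16 l)) k :=
  Fin.append_left _ _ k

lemma blockEnd_natAdd (v : Pt) (a : Fin 16) :
    blockEnd P v (Fin.natAdd 8 a) = (P.1 *ᵥ fun b => v (Fin.natAdd 8 b)) a :=
  Fin.append_right _ _ a

lemma blockEnd_single_natAdd (a b : Fin 16) :
    blockEnd P (Pi.single (Fin.natAdd 8 b) 1) (Fin.natAdd 8 a) = P.1 a b := by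
  rw [blockEnd_natAdd, single_natAdd_natAdd, Matrix.mulVec_single_one, Matrix.col_apply]

lemma blockEnd_single_castAdd (k l : Fin 8) :
    blockEnd P (Pi.single (Fin.castAdd 16 l) 1) (Fin.castAdd 16 k) = P.2 k l := by
  rw [blockEnd_castAdd, single_castAdd_castAdd, Matrix.mulVec_single_one, Matrix.col_apply]

lemma blockEnd_injective : Function.Injective blockEnd := by
  intro P Q h
  ext a b
  · rw [← blockEnd_single_natAdd, h, blockEnd_single_natAdd]
  · rw [← blockEnd_single_castAdd, h, blockEnd_single_castAdd]

lemma blockEnd_leibniz_iff :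
    (∀ v w, blockEnd P (br v w) = br (blockEnd P v) w + br v (blockEnd P w)) ↔
      P ∈ derPairs := by
  have left (v w : Pt) (k : Fin 8) : blockEnd P (br v w) (Fin.castAdd 16 k) =
      (fun a => v (Fin.natAdd 8 a)) ⬝ᵥ
        (∑ l, P.2 k l • structMat l) *ᵥ fun a => w (Fin.natAdd 8 a) := by
    rw [blockEnd_castAdd, Matrix.sum_mulVec, dotProduct_sum]
    simp only [Matrix.mulVec, br_castAdd, Matrix.smul_mulVec, dotProduct_smul, smul_eq_mul]
    rfl
  have right (v w : Pt) (k : Fin 8) :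
      (br (blockEnd P v) w + br v (blockEnd P w)) (Fin.castAdd 16 k) =
      (fun a => v (Fin.natAdd 8 a)) ⬝ᵥ
        (P.1ᵀ * structMat k + structMat k * P.1) *ᵥ fun a => w (Fin.natAdd 8 a) := by
    simp only [Pi.add_apply, br_castAdd, blockEnd_natAdd, Matrix.add_mulVec, dotProduct_add,
      ← Matrix.mulVec_mulVec]
    rw [Matrix.dotProduct_mulVec _ P.1ᵀ, Matrix.vecMul_transpose]
  constructor
  · intro h k
    ext a b
    have e := congrFun (h (Pi.single (Fin.natAdd 8 a) 1) (Pi.single (Fin.natAdd 8 b) 1))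
      (Fin.castAdd 16 k)
    rw [left, right, single_natAdd_natAdd, single_natAdd_natAdd] at e
    simpa using e.symm
  · intro h v w
    ext i
    refine Fin.addCases (m := 8) (n := 16) (fun k => ?_) (fun a => ?_) i
    · rw [left, right, h k]
    · rw [blockEnd_natAdd, Pi.add_apply]
      simp [br_natAdd, Matrix.mulVec, dotProduct]

end BlockEnd

lemma mem_Nm1_iff (v : Pt) : v ∈ Nm1 ↔ ∀ k : Fin 8, v (Fin.castAdd 16 k) = 0 :=
  ⟨fun h k => h _ k.2, fun h k hk => h ⟨k, hk⟩⟩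

lemma mem_Nm2_iff (v : Pt) : v ∈ Nm2 ↔ ∀ a : Fin 16, v (Fin.natAdd 8 a) = 0 := by
  refine ⟨fun h a => h _ (by simp), fun h k => ?_⟩
  refine Fin.addCases (m := 8) (n := 16) (fun k hk => ?_) (fun a _ => h a) k
  exact absurd k.2 (not_lt.2 hk)

lemma isSPDer_iff (A : Module.End ℝ Pt) : IsSPDer A ↔ A ∈ derPairs.map blockEnd := by
  constructor
  · rintro ⟨h1, h2, h3⟩
    let P : Matrix (Fin 16) (Fin 16) ℝ × Matrix (Fin 8) (Fin 8) ℝ :=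
      (fun a b => A (Pi.single (Fin.natAdd 8 b) 1) (Fin.natAdd 8 a),
        fun k l => A (Pi.single (Fin.castAdd 16 l) 1) (Fin.castAdd 16 k))
    have hP : blockEnd P = A := by
      refine LinearMap.pi_ext' fun j => LinearMap.ext_ring (funext fun i => ?_)
      simp only [LinearMap.comp_apply, LinearMap.single_apply]
      refine Fin.addCases (m := 8) (n := 16) (fun l => ?_) (fun b => ?_) j <;>
        refine Fin.addCases (m := 8) (n := 16) (fun k => ?_) (fun a => ?_) i
      · exact blockEnd_single_castAdd P k l
      · have := h2 _ ((mem_Nm2_iff _).2 (congrFun (single_castAdd_natAdd l)))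
        rw [(mem_Nm2_iff _).1 this a, blockEnd_natAdd, single_castAdd_natAdd, Matrix.mulVec_zero,
          Pi.zero_apply]
      · have := h1 _ ((mem_Nm1_iff _).2 (congrFun (single_natAdd_castAdd b)))
        rw [(mem_Nm1_iff _).1 this k, blockEnd_castAdd, single_natAdd_castAdd, Matrix.mulVec_zero,
          Pi.zero_apply]
      · exact blockEnd_single_natAdd P a b
    exact ⟨P, (blockEnd_leibniz_iff P).1 (hP ▸ h3), hP⟩
  · rintro ⟨P, hP, rfl⟩
    refine ⟨fun v hv => (mem_Nm1_iff _).2 fun k => ?_, fun v hv => (mem_Nm2_iff _).2 fun a => ?_,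
      (blockEnd_leibniz_iff P).2 hP⟩
    · simp [blockEnd_castAdd, (mem_Nm1_iff v).1 hv, Matrix.mulVec, dotProduct]
    · simp [blockEnd_natAdd, (mem_Nm2_iff v).1 hv, Matrix.mulVec, dotProduct]

lemma br_sub_left (u v w : Pt) : br (u - v) w = br u w - br v w := by
  ext i
  refine Fin.addCases (m := 8) (n := 16) (fun k => ?_) (fun a => ?_) i
  · simp only [Pi.sub_apply, br_castAdd, dotProduct, sub_mul, Finset.sum_sub_distrib]
  · simp only [Pi.sub_apply, br_natAdd, sub_zero]

lemma br_sub_right (u v w : Pt) : br u (v - w) = br u v - br u w := by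
  ext i
  refine Fin.addCases (m := 8) (n := 16) (fun k => ?_) (fun a => ?_) i
  · simp only [Pi.sub_apply, br_castAdd, dotProduct, Matrix.mulVec, mul_sub,
      Finset.sum_sub_distrib]
  · simp only [Pi.sub_apply, br_natAdd, sub_zero]

lemma IsSPDer.commutator {A B : Module.End ℝ Pt} (hA : IsSPDer A) (hB : IsSPDer B) :
    IsSPDer (A * B - B * A) := by
  refine ⟨fun v hv => sub_mem (hA.1 _ (hB.1 v hv)) (hB.1 _ (hA.1 v hv)),
    fun v hv => sub_mem (hA.2.1 _ (hB.2.1 v hv)) (hB.2.1 _ (hA.2.1 v hv)), fun v w => ?_⟩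
  simp only [LinearMap.sub_apply, Module.End.mul_apply, hA.2.2, hB.2.2, map_add, br_sub_left,
    br_sub_right]
  abel

lemma derPairs_snd_apply {P : Matrix (Fin 16) (Fin 16) ℝ × Matrix (Fin 8) (Fin 8) ℝ}
    (hP : P ∈ derPairs) (k l : Fin 8) :
    8 * P.2 k l = -(P.1 * (structMat l * structMat k)).trace := by
  have h := congrArg (fun X => (X * structMat l).trace) (hP k)
  simp only [add_mul, Matrix.trace_add, Finset.sum_mul, Matrix.trace_sum, Matrix.smul_mul,
    Matrix.trace_smul, trace_structMat_mul, smul_eq_mul, mul_ite, mul_zero,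
    Finset.sum_ite_eq', Finset.mem_univ, if_true] at h
  have h1 : (P.1ᵀ * structMat k * structMat l).trace =
      (P.1 * (structMat l * structMat k)).trace := by
    rw [← Matrix.trace_transpose, Matrix.transpose_mul, Matrix.transpose_mul,
      Matrix.transpose_transpose, structMat_transpose, structMat_transpose, neg_mul,
      neg_mul, mul_neg, neg_neg, ← mul_assoc, Matrix.trace_mul_comm]
  have h2 : (structMat k * P.1 * structMat l).trace =
      (P.1 * (structMat l * structMat k)).trace := by
    rw [mul_assoc, Matrix.trace_mul_comm, mul_assoc]
  linarith

lemma derPairs_snd_swap {P : Matrix (Fin 16) (Fin 16) ℝ × Matrix (Fin 8) (Fin 8) ℝ}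
    (hP : P ∈ derPairs) (k l : Fin 8) : P.2 k l = commSign l k * P.2 l k := by
  have h1 := derPairs_snd_apply hP k l
  have h2 := derPairs_snd_apply hP l k
  rw [structMat_mul_comm l k, Matrix.mul_smul, Matrix.trace_smul, smul_eq_mul] at h1
  linear_combination (h1 - commSign l k * h2) / 8

lemma derPairs_snd_diag {P : Matrix (Fin 16) (Fin 16) ℝ × Matrix (Fin 8) (Fin 8) ℝ}
    (hP : P ∈ derPairs) (k l : Fin 8) : P.2 k k = P.2 l l := by
  have h1 := derPairs_snd_apply hP k k
  have h2 := derPairs_snd_apply hP l l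
  rw [structMat_mul_self] at h1 h2
  linarith

/-- Bookkeeping for the effect of the symmetry `M ↦ structMat k * Mᵀ * structMat k`, applied
along a word in the indices `k`, on a signed matrix position. -/
def transport : List (Fin 8) → ℤ × Fin 16 × Fin 16 → ℤ × Fin 16 × Fin 16
  | [], p => p
  | k :: w, (c, i, j) =>
    transport w (-(c * (partnerSign k i * partnerSign k j)), partner k j, partner k i)

lemma transport_apply {M : Matrix (Fin 16) (Fin 16) ℝ}
    (hM : ∀ k, structMat k * Mᵀ * structMat k = M) (w : List (Fin 8)) (c : ℤ) (i j : Fin 16) :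
    (transport w (c, i, j)).1 * M (transport w (c, i, j)).2.1 (transport w (c, i, j)).2.2 =
      c * M i j := by
  induction w generalizing c i j with
  | nil => rfl
  | cons k w ih =>
    rw [transport, ih]
    conv_rhs => rw [← hM k]
    rw [mul_structMat_apply, structMat_mul_apply, Matrix.transpose_apply]
    push_cast
    ring

/-- Every matrix position is carried to itself with a change of sign, or to `(15, 7)`. -/
lemma exists_transport (i j : Fin 16) :
    ∃ w ∈ ([[0, 1, 2, 4], [0, 1, 5, 6], [0, 2, 3, 5], [0, 1, 3], [0], [1], [2], [3], [4], [5],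
        [6], [0, 1], [0, 2], [0, 3], [0, 4], [0, 5], [0, 6], [1, 3]] : List (List (Fin 8))),
      transport w (1, i, j) = (-1, i, j) ∨
        (transport w (1, i, j)).2 = (15, 7) := by
  revert i j; decide +kernel

lemma eq_zero_of_invariant {M : Matrix (Fin 16) (Fin 16) ℝ}
    (hM : ∀ k, structMat k * Mᵀ * structMat k = M) (h0 : M 15 7 = 0) : M = 0 := by
  ext i j
  obtain ⟨w, -, h | h⟩ := exists_transport i j
  · have e := transport_apply hM w 1 i j
    rw [h] at e
    push_cast at e
    rw [Matrix.zero_apply]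
    linarith
  · have e := transport_apply hM w 1 i j
    rw [h, h0] at e
    simpa using e.symm

/-- The index set for coordinates on the strata-preserving derivations. -/
abbrev DerIndex : Type := {p : Fin 8 × Fin 8 // p.2 < p.1} ⊕ Bool

/-- The entries determining a strata-preserving derivation. -/
def derCoords : derPairs →ₗ[ℝ] DerIndex → ℝ where
  toFun P := Sum.elim (fun p => P.1.2 p.1.1 p.1.2)
    fun b => if b then P.1.2 7 7 else P.1.1 15 7
  map_add' P Q := by
    ext (p | _ | _) <;> simp
  map_smul' c P := by
    ext (p | _ | _) <;> simp

lemma derCoords_injective : Function.Injective derCoords := by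
  refine (injective_iff_map_eq_zero _).2 fun ⟨P, hP⟩ h => ?_
  have hlow (k l : Fin 8) (hkl : l < k) : P.2 k l = 0 := congrFun h (Sum.inl ⟨(k, l), hkl⟩)
  have hdiag : P.2 7 7 = 0 := congrFun h (Sum.inr true)
  have h0 : P.1 15 7 = 0 := congrFun h (Sum.inr false)
  have hsnd : P.2 = 0 := by
    ext k l
    rcases lt_trichotomy k l with hkl | rfl | hkl
    · rw [derPairs_snd_swap hP, hlow l k hkl, mul_zero, Matrix.zero_apply]
    · rw [derPairs_snd_diag hP k 7, hdiag, Matrix.zero_apply]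
    · exact hlow k l hkl
  have hfst : P.1 = 0 := by
    refine eq_zero_of_invariant (fun k => ?_) h0
    have e := hP k
    simp only [hsnd, Matrix.zero_apply, zero_smul, Finset.sum_const_zero] at e
    rw [mul_assoc, eq_neg_of_add_eq_zero_left e, mul_neg, ← mul_assoc, structMat_mul_self]
    simp
  exact Subtype.ext (Prod.ext hfst hsnd)

/-- The derivation pair rotating the directions `k` and `l` of the centre. -/
def rotPair (k l : Fin 8) : Matrix (Fin 16) (Fin 16) ℝ × Matrix (Fin 8) (Fin 8) ℝ :=
  (-(1 / 2 : ℝ) • (structMat k * structMat l),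
    Matrix.single k l 1 + Matrix.single l k (commSign k l : ℝ))

lemma commSign_triple (k l m : Fin 8) (hkl : k ≠ l) (hkm : k ≠ m) (hlm : l ≠ m) :
    commSign l k * commSign k m * commSign l m = -1 := by
  revert k l m; decide +kernel

lemma rotPair_mem (k l : Fin 8) (hkl : k ≠ l) : rotPair k l ∈ derPairs := by
  intro m
  have hsum : ∑ n, (rotPair k l).2 m n • structMat n =
      (if m = k then structMat l else 0) +
        if m = l then (commSign k l : ℝ) • structMat k else 0 := by
    simp only [rotPair, Matrix.add_apply, add_smul, Finset.sum_add_distrib]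
    congr 1
    · split_ifs with h
      · subst h
        simp [Matrix.single_apply]
      · simp [Ne.symm h]
    · split_ifs with h
      · subst h
        simp [Matrix.single_apply]
      · simp [Ne.symm h]
  have hlhs : (rotPair k l).1ᵀ * structMat m + structMat m * (rotPair k l).1 =
      -(1 / 2 : ℝ) • (structMat l * (structMat k * structMat m) +
        structMat m * (structMat k * structMat l)) := by
    simp only [rotPair, Matrix.transpose_smul, Matrix.transpose_mul, structMat_transpose,
      neg_mul_neg, Matrix.smul_mul, Matrix.mul_smul, smul_add, mul_assoc]
  rw [hsum, hlhs]
  by_cases hmk : m = k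
  · subst hmk
    rw [if_pos rfl, if_neg hkl, structMat_mul_self, ← mul_assoc, structMat_mul_self]
    simp only [mul_neg, mul_one, neg_mul, one_mul, add_zero]
    module
  by_cases hml : m = l
  · subst hml
    rw [if_neg hmk, if_pos rfl, structMat_mul_comm k m, Matrix.mul_smul, ← mul_assoc,
      structMat_mul_self, neg_mul, one_mul]
    module
  · have h3 : (commSign l k * commSign k m * commSign l m : ℝ) = -1 :=
      mod_cast commSign_triple k l m hkl (Ne.symm hmk) (Ne.symm hml)
    rw [if_neg hmk, if_neg hml, structMat_mul_comm k m, Matrix.mul_smul, ← mul_assoc,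
      structMat_mul_comm l m, Matrix.smul_mul, mul_assoc, structMat_mul_comm l k,
      Matrix.mul_smul, smul_smul, smul_smul,
      show (commSign k m * commSign l m * commSign l k : ℝ) = -1 by linarith]
    module

lemma structMat_mul_apply_last (k l : Fin 8) (hkl : k ≠ l) :
    (structMat k * structMat l) 15 7 = 0 := by
  have h : (7 : Fin 16) ≠ partner l (partner k 15) := by
    revert k l; decide +kernel
  simp [structMat_mul_apply, structMat, h]

lemma exists_derCoords_eq_single (i : DerIndex) : ∃ P, derCoords P = Pi.single i 1 := by
  rcases i with ⟨⟨k, l⟩, hkl⟩ | _ | _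
  · refine ⟨⟨rotPair k l, rotPair_mem k l hkl.ne'⟩, ?_⟩
    ext (⟨⟨m, n⟩, hmn⟩ | _ | _)
    · have h : ¬(l = m ∧ k = n) := by
        rintro ⟨rfl, rfl⟩
        exact lt_asymm hkl hmn
      simp [derCoords, rotPair, Matrix.single_apply, Pi.single_apply, h, eq_comm]
    · simp [derCoords, rotPair, structMat_mul_apply_last k l hkl.ne']
    · have h : ¬(k = 7 ∧ l = 7) := fun h => hkl.ne (h.2.trans h.1.symm)
      have h' : ¬(l = 7 ∧ k = 7) := fun h => hkl.ne (h.1.trans h.2.symm)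
      simp [derCoords, rotPair, Matrix.single_apply, h, h']
  · refine ⟨⟨(structMat 7, 0), fun k => ?_⟩, ?_⟩
    · have h := structMat_mul_comm 7 k
      simp only [commSign] at h
      simp [structMat_transpose, h]
    · ext (p | _ | _) <;> simp [derCoords, structMat, partner, partnerSign]
  · refine ⟨⟨((1 / 2 : ℝ) • 1, 1), fun k => ?_⟩, ?_⟩
    · simp only [Matrix.transpose_smul, Matrix.transpose_one, Matrix.smul_mul, Matrix.mul_smul,
        one_mul, mul_one, Matrix.one_apply, ite_smul, one_smul, zero_smul, Finset.sum_ite_eq,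
        Finset.mem_univ, if_true]
      module
    · ext (p | _ | _)
      · simp [derCoords, p.2.ne']
      all_goals simp [derCoords]

lemma derCoords_surjective : Function.Surjective derCoords := by
  intro c
  choose P hP using exists_derCoords_eq_single
  refine ⟨∑ i, c i • P i, ?_⟩
  simp only [map_sum, map_smul, hP]
  exact (pi_eq_sum_univ' c).symm

lemma finrank_derPairs : Module.finrank ℝ derPairs = 30 := by
  rw [(LinearEquiv.ofBijective derCoords
    ⟨derCoords_injective, derCoords_surjective⟩).finrank_eq, Module.finrank_fintype_fun_eq_card]
  decide +kernel

/-- The strata-preserving derivations of the 2-step nilpotent Lie algebra `n_{E_III}`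
form a Lie subalgebra of `gl(n_{E_III})` of real dimension 30. -/
theorem nEIII_strata_preserving_derivations_dim_30 :
    ∃ W : Submodule ℝ (Module.End ℝ Pt),
      -- the strata-preserving derivations form a linear subspace of gl(n) …
      (W : Set (Module.End ℝ Pt)) = {A : Module.End ℝ Pt | IsSPDer A} ∧
      -- … closed under the commutator bracket, i.e. a Lie subalgebra of gl(n), …
      (∀ A ∈ W, ∀ B ∈ W, A * B - B * A ∈ W) ∧
      -- … of real dimension 30.
      Module.finrank ℝ ↥W = 30 := by
  refine ⟨derPairs.map blockEnd, ?_, fun A hA B hB => ?_, ?_⟩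
  · ext A
    exact (isSPDer_iff A).symm
  · rw [← isSPDer_iff] at hA hB ⊢
    exact hA.commutator hB
  · exact (Submodule.equivMapOfInjective blockEnd blockEnd_injective
      derPairs).finrank_eq.symm.trans finrank_derPairs
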